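/- arXiv:1804.08097 — 4 statements merged into one kernel-verified Lean document; each statement's English description precedes it below -/
import Mathlib

section
/- (Lemma 1, non-bipartite form.) Let V be a finite set of requests of even cardinality with positions pos : V → X in a metric space X and arrival times atime : V → ℝ. Let M be a perfect matching on V together with match times τ : M → ℝ satisfying τ({u,v}) ≥ atime(u) and τ({u,v}) ≥ atime(v) for every pair. Let y : 𝒫(V) → ℝ≥0 satisfy, for every unordered pair e = {u,v} of distinct requests, Σ_{S : e ∈ δ(S)} y_S ≤ dist(pos(u),pos(v)) + |atime(u) − atime(v)|. Then the total cost Σ_{{u,v} ∈ M} [ dist(pos(u),pos(v)) + (τ({u,v}) − atime(u)) + (τ({u,v}) − atime(v)) ] is at least Σ_{S ⊆ V, |S| odd} y_S. -/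
/-- A perfect matching has a pair in the cut `δ(S)` of every odd set `S`. -/
theorem exists_mem_cut_of_odd_card {V : Type*} [DecidableEq V] {M : Finset (V × V)}
    (hpair : ∀ p ∈ M, p.1 ≠ p.2)
    (hperfect : ∀ x : V, ∃! p, p ∈ M ∧ (x = p.1 ∨ x = p.2))
    {S : Finset V} (hS : Odd S.card) :
    ∃ p ∈ M, (p.1 ∈ S ∧ p.2 ∉ S) ∨ (p.1 ∉ S ∧ p.2 ∈ S) := by
  by_contra! hcut
  choose f hf hunique using hperfect
  rw [← Nat.not_even_iff_odd,
    Finset.card_eq_sum_card_fiberwise (f := f) (t := M) fun x _ => (hf x).1] at hS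
  refine hS (Finset.even_sum _ fun p hp => ?_)
  have hmem (x : V) : f x = p ↔ x = p.1 ∨ x = p.2 :=
    ⟨fun h => h ▸ (hf x).2, fun h => (hunique x p ⟨hp, h⟩).symm⟩
  obtain ⟨hleft, hright⟩ := hcut p hp
  by_cases h : p.1 ∈ S
  · have : S.filter (fun x => f x = p) = {p.1, p.2} := by
      ext x
      simp only [Finset.mem_filter, Finset.mem_insert, Finset.mem_singleton, hmem]
      grind
    rw [this, Finset.card_pair (hpair p hp)]
    exact even_two
  · have : S.filter (fun x => f x = p) = ∅ := by
      ext x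
      simp only [Finset.mem_filter, hmem]
      grind
    simp [this]

/-- The value of a nonnegative `y` on odd sets is at most its total load on the pairs of a
perfect matching. -/
theorem sum_odd_card_le_sum_cut {V : Type*} [Fintype V] [DecidableEq V] {M : Finset (V × V)}
    (hpair : ∀ p ∈ M, p.1 ≠ p.2)
    (hperfect : ∀ x : V, ∃! p, p ∈ M ∧ (x = p.1 ∨ x = p.2))
    {y : Finset V → ℝ} (hy : ∀ S, 0 ≤ y S) :
    ∑ S ∈ Finset.univ.filter (fun S : Finset V => Odd S.card), y S ≤
      ∑ p ∈ M, ∑ S ∈ Finset.univ.filter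
        (fun S : Finset V => (p.1 ∈ S ∧ p.2 ∉ S) ∨ (p.1 ∉ S ∧ p.2 ∈ S)), y S := by
  simp only [Finset.sum_filter]
  rw [Finset.sum_comm]
  refine Finset.sum_le_sum fun S _ => ?_
  have hnonneg : ∀ p ∈ M,
      0 ≤ if (p.1 ∈ S ∧ p.2 ∉ S) ∨ (p.1 ∉ S ∧ p.2 ∈ S) then y S else 0 :=
    fun p _ => ite_nonneg (hy S) le_rfl
  split_ifs with hS
  · obtain ⟨p, hp, hcut⟩ := exists_mem_cut_of_odd_card hpair hperfect hS
    simpa only [if_pos hcut] using Finset.single_le_sum hnonneg hp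
  · exact Finset.sum_nonneg hnonneg


/-- Lemma 1, non-bipartite form. For an MPMD instance with a
perfect matching `M` (with match times `τ` at least the arrival times of both
endpoints) and a dual-feasible `y ≥ 0` (w.r.t. the costs
`dist(pos u, pos v) + |atime u − atime v|`), the total cost of the matching is at
least `Σ_{S ⊆ V, |S| odd} y_S`. -/
theorem stmt_3 {V : Type*} [Fintype V] [DecidableEq V]
    {X : Type*} [MetricSpace X]
    (hV : Even (Fintype.card V))
    (pos : V → X) (atime : V → ℝ)
    (M : Finset (V × V))
    (hpair : ∀ p ∈ M, p.1 ≠ p.2)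
    (hperfect : ∀ x : V, ∃! p, p ∈ M ∧ (x = p.1 ∨ x = p.2))
    (τ : V × V → ℝ)
    (hτ : ∀ p ∈ M, atime p.1 ≤ τ p ∧ atime p.2 ≤ τ p)
    (y : Finset V → ℝ) (hynonneg : ∀ S : Finset V, 0 ≤ y S)
    (hdual : ∀ u v : V, u ≠ v →
      ∑ S ∈ Finset.univ.filter (fun S : Finset V => (u ∈ S ∧ v ∉ S) ∨ (u ∉ S ∧ v ∈ S)),
        y S ≤ dist (pos u) (pos v) + |atime u - atime v|) :
    ∑ S ∈ Finset.univ.filter (fun S : Finset V => Odd S.card), y S ≤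
      ∑ p ∈ M, (dist (pos p.1) (pos p.2) + (τ p - atime p.1) + (τ p - atime p.2)) := by
  refine (sum_odd_card_le_sum_cut hpair hperfect hynonneg).trans
    (Finset.sum_le_sum fun p hp => (hdual p.1 p.2 (hpair p hp)).trans ?_)
  obtain ⟨h₁, h₂⟩ := hτ p hp
  have : |atime p.1 - atime p.2| ≤ (τ p - atime p.1) + (τ p - atime p.2) :=
    abs_le.2 ⟨by linarith, by linarith⟩
  linarith
end

section
/- (Lemma 1, bipartite form.) Let V be a finite set of requests with a sign function sgn : V → {−1,+1}, positions pos : V → X in a metric space X, and arrival times atime : V → ℝ. Let M be a perfect matching on V in which every pair has opposite signs, together with match times τ : M → ℝ satisfying τ({u,v}) ≥ atime(u) and τ({u,v}) ≥ atime(v). Let y : 𝒫(V) → ℝ≥0 satisfy, for every unordered pair e = {u,v} of requests with sgn(u) = −sgn(v), Σ_{S : e ∈ δ(S)} y_S ≤ dist(pos(u),pos(v)) + |atime(u) − atime(v)|. Then Σ_{{u,v} ∈ M} [ dist(pos(u),pos(v)) + (τ({u,v}) − atime(u)) + (τ({u,v}) − atime(v)) ] ≥ Σ_{S ⊆ V}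 |Σ_{u∈S} sgn(u)| · y_S. -/
/-- A sum over all vertices can be grouped along the pairs of a perfect matching. -/
lemma sum_univ_eq_sum_perfectMatching {V R : Type*} [Fintype V] [DecidableEq V] [AddCommMonoid R]
    (M : Finset (V × V)) (hpair : ∀ p ∈ M, p.1 ≠ p.2)
    (hperfect : ∀ x : V, ∃! p, p ∈ M ∧ (x = p.1 ∨ x = p.2)) (f : V → R) :
    ∑ x, f x = ∑ p ∈ M, (f p.1 + f p.2) := by
  have hcover : ∀ x, f x = ∑ p ∈ M, if x = p.1 ∨ x = p.2 then f x else 0 := by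
    intro x
    obtain ⟨p, ⟨hpM, hxp⟩, huniq⟩ := hperfect x
    rw [Finset.sum_eq_single p]
    · rw [if_pos hxp]
    · intro q hq hqp
      exact if_neg fun h => hqp (huniq q ⟨hq, h⟩)
    · exact fun h => absurd hpM h
  rw [Finset.sum_congr rfl fun x _ => hcover x, Finset.sum_comm]
  refine Finset.sum_congr rfl fun p hp => ?_
  have hfilter : Finset.univ.filter (fun x => x = p.1 ∨ x = p.2) = {p.1, p.2} := by
    ext x
    simp
  rw [← Finset.sum_filter, hfilter, Finset.sum_pair (hpair p hp)]

/-- The surplus of `S` is at most the number of pairs of a sign-respecting perfect matching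
that are separated by `S`. -/
lemma abs_sum_sgn_le_sum_separated {V : Type*} [Fintype V] [DecidableEq V]
    (sgn : V → ℤ) (hsgn : ∀ u, sgn u = 1 ∨ sgn u = -1)
    (M : Finset (V × V)) (hpair : ∀ p ∈ M, p.1 ≠ p.2)
    (hperfect : ∀ x : V, ∃! p, p ∈ M ∧ (x = p.1 ∨ x = p.2))
    (hopp : ∀ p ∈ M, sgn p.1 = - sgn p.2) (S : Finset V) :
    |∑ u ∈ S, sgn u| ≤
      ∑ p ∈ M, if (p.1 ∈ S ∧ p.2 ∉ S) ∨ (p.1 ∉ S ∧ p.2 ∈ S) then 1 else 0 := by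
  have hS : ∑ u ∈ S, sgn u = ∑ u, if u ∈ S then sgn u else 0 := by
    simp
  rw [hS, sum_univ_eq_sum_perfectMatching M hpair hperfect]
  refine (Finset.abs_sum_le_sum_abs _ _).trans (Finset.sum_le_sum fun p hp => ?_)
  have hp := hopp p hp
  by_cases h1 : p.1 ∈ S <;> by_cases h2 : p.2 ∈ S <;>
    rcases hsgn p.2 with h | h <;> simp [h1, h2, hp, h]


/-- Lemma 1, bipartite form. For an MBPMD instance with a
sign-respecting perfect matching `M` (with match times `τ` at least the arrival
times of both endpoints) and `y ≥ 0` feasible for the dual constraints of all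
opposite-sign pairs, the total cost of the matching is at least
`Σ_{S ⊆ V} |Σ_{u ∈ S} sgn u| · y_S`. -/
theorem stmt_4 {V : Type*} [Fintype V] [DecidableEq V]
    {X : Type*} [MetricSpace X]
    (sgn : V → ℤ) (hsgn : ∀ u, sgn u = 1 ∨ sgn u = -1)
    (pos : V → X) (atime : V → ℝ)
    (M : Finset (V × V))
    (hpair : ∀ p ∈ M, p.1 ≠ p.2)
    (hperfect : ∀ x : V, ∃! p, p ∈ M ∧ (x = p.1 ∨ x = p.2))
    (hopp : ∀ p ∈ M, sgn p.1 = - sgn p.2)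
    (τ : V × V → ℝ)
    (hτ : ∀ p ∈ M, atime p.1 ≤ τ p ∧ atime p.2 ≤ τ p)
    (y : Finset V → ℝ) (hynonneg : ∀ S : Finset V, 0 ≤ y S)
    (hdual : ∀ u v : V, u ≠ v → sgn u = - sgn v →
      ∑ S ∈ Finset.univ.filter (fun S : Finset V => (u ∈ S ∧ v ∉ S) ∨ (u ∉ S ∧ v ∈ S)),
        y S ≤ dist (pos u) (pos v) + |atime u - atime v|) :
    ∑ S : Finset V, ((|∑ u ∈ S, sgn u| : ℤ) : ℝ) * y S ≤
      ∑ p ∈ M, (dist (pos p.1) (pos p.2) + (τ p - atime p.1) + (τ p - atime p.2)) := by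
  have hsurplus : ∀ S : Finset V, ((|∑ u ∈ S, sgn u| : ℤ) : ℝ) * y S ≤
      ∑ p ∈ M, if (p.1 ∈ S ∧ p.2 ∉ S) ∨ (p.1 ∉ S ∧ p.2 ∈ S) then y S else 0 := by
    intro S
    have h : ((|∑ u ∈ S, sgn u| : ℤ) : ℝ) ≤
        ((∑ p ∈ M, if (p.1 ∈ S ∧ p.2 ∉ S) ∨ (p.1 ∉ S ∧ p.2 ∈ S) then 1 else 0 : ℤ) : ℝ) :=
      Int.cast_le.mpr (abs_sum_sgn_le_sum_separated sgn hsgn M hpair hperfect hopp S)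
    refine (mul_le_mul_of_nonneg_right h (hynonneg S)).trans_eq ?_
    push_cast
    simp only [Finset.sum_mul, ite_mul, one_mul, zero_mul]
  refine (Finset.sum_le_sum fun S _ => hsurplus S).trans ?_
  rw [Finset.sum_comm]
  refine Finset.sum_le_sum fun p hp => ?_
  rw [← Finset.sum_filter]
  refine (hdual p.1 p.2 (hpair p hp) (hopp p hp)).trans ?_
  obtain ⟨h1, h2⟩ := hτ p hp
  have htime : |atime p.1 - atime p.2| ≤ (τ p - atime p.1) + (τ p - atime p.2) :=
    abs_le.mpr ⟨by linarith, by linarith⟩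
  linarith
end

section
/- Let G be an acyclic simple graph (a forest) on a vertex type V and let S be a set of vertices such that the subgraph of G induced on S is connected. Then for every path P in G (between any two vertices u and v), the number of edges of P having exactly one endpoint in S is at most 2. -/
namespace SimpleGraph.Walk

variable {V : Type*} {G : SimpleGraph V}

/-- The number of darts of a walk that cross the boundary of `S`. -/
def boundaryCrossings (S : Set V) [DecidablePred (· ∈ S)] {u v : V} (p : G.Walk u v) : ℕ :=
  (p.darts.filter (fun d =>
    (d.toProd.1 ∈ S ∧ d.toProd.2 ∉ S) ∨ (d.toProd.1 ∉ S ∧ d.toProd.2 ∈ S))).length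

variable (S : Set V) [DecidablePred (· ∈ S)]

lemma boundaryCrossings_cons {u v w : V} (h : G.Adj u v) (p : G.Walk v w) :
    (cons h p).boundaryCrossings S =
      (if (u ∈ S ∧ v ∉ S) ∨ (u ∉ S ∧ v ∈ S) then 1 else 0) + p.boundaryCrossings S := by
  unfold boundaryCrossings
  rw [darts_cons, List.filter_cons]
  split_ifs <;> simp_all [add_comm]

lemma boundaryCrossings_eq_zero_of_support_disjoint {u v : V} (p : G.Walk u v)
    (h : ∀ x ∈ p.support, x ∉ S) : p.boundaryCrossings S = 0 := by
  unfold boundaryCrossings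
  rw [List.length_eq_zero_iff, List.filter_eq_nil_iff]
  intro d hd
  simp [h _ (p.dart_fst_mem_support_of_mem_darts hd),
    h _ (p.dart_snd_mem_support_of_mem_darts hd)]

end SimpleGraph.Walk

namespace SimpleGraph.IsAcyclic

open Walk

variable {V : Type*} {G : SimpleGraph V} {S : Set V}

/-- In a forest, a vertex set inducing a connected subgraph is closed under taking paths. -/
lemma support_subset_of_induce_preconnected (hG : G.IsAcyclic) (hS : (G.induce S).Preconnected)
    {u v : V} (hu : u ∈ S) (hv : v ∈ S) {p : G.Walk u v} (hp : p.IsPath) :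
    ∀ x ∈ p.support, x ∈ S := by
  obtain ⟨q, hq⟩ := (hS ⟨u, hu⟩ ⟨v, hv⟩).exists_isPath
  have hq' : (q.map (Embedding.induce S).toHom).IsPath := hq.map Subtype.val_injective
  have hpq : p = q.map (Embedding.induce S).toHom :=
    congrArg Subtype.val ((hG.subsingleton_path u v).elim ⟨p, hp⟩ ⟨_, hq'⟩)
  have hsupp : p.support = q.support.map Subtype.val :=
    (congrArg Walk.support hpq).trans (Walk.support_map (Embedding.induce S).toHom q)
  intro x hx
  rw [hsupp, List.mem_map] at hx
  obtain ⟨y, -, rfl⟩ := hx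
  exact y.2

variable [DecidablePred (· ∈ S)]

lemma boundaryCrossings_le_one (hG : G.IsAcyclic) (hS : (G.induce S).Preconnected)
    {u v : V} (hu : u ∈ S) {p : G.Walk u v} (hp : p.IsPath) :
    p.boundaryCrossings S ≤ 1 := by
  classical
  induction p with
  | nil => simp [boundaryCrossings]
  | @cons u w v h p ih =>
    rw [boundaryCrossings_cons]
    by_cases hw : w ∈ S
    · simpa [hu, hw] using ih hw hp.of_cons
    · have hout : ∀ x ∈ p.support, x ∉ S := fun x hx hxS ↦ by
        have hpath : (cons h (p.takeUntil x hx)).IsPath := by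
          rw [cons_isPath_iff] at hp ⊢
          exact ⟨hp.1.takeUntil hx, fun hmem ↦ hp.2 (p.support_takeUntil_subset_support hx hmem)⟩
        exact hw (hG.support_subset_of_induce_preconnected hS hu hxS hpath w (by simp))
      rw [boundaryCrossings_eq_zero_of_support_disjoint S p hout]
      split_ifs <;> simp

lemma boundaryCrossings_le_two (hG : G.IsAcyclic) (hS : (G.induce S).Preconnected)
    {u v : V} {p : G.Walk u v} (hp : p.IsPath) :
    p.boundaryCrossings S ≤ 2 := by
  induction p with
  | nil => simp [boundaryCrossings]
  | @cons u w v h p ih =>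
    by_cases hu : u ∈ S
    · exact (hG.boundaryCrossings_le_one hS hu hp).trans one_le_two
    · rw [boundaryCrossings_cons]
      by_cases hw : w ∈ S
      · have := hG.boundaryCrossings_le_one hS hw hp.of_cons
        split_ifs <;> omega
      · simpa [hu, hw] using ih hp.of_cons

end SimpleGraph.IsAcyclic


/-- In a forest `G`, if the subgraph induced on a vertex set `S`
is connected, then any path of `G` crosses the boundary of `S` at most twice,
i.e. it has at most two edges with exactly one endpoint in `S`. -/
theorem stmt_6 {V : Type*} (G : SimpleGraph V) (hG : G.IsAcyclic)
    (S : Set V) [DecidablePred (· ∈ S)]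
    (hconn : (G.induce S).Connected)
    (u v : V) (p : G.Walk u v) (hp : p.IsPath) :
    (p.darts.filter (fun d =>
      (d.toProd.1 ∈ S ∧ d.toProd.2 ∉ S) ∨ (d.toProd.1 ∉ S ∧ d.toProd.2 ∈ S))).length ≤ 2 := by
  exact hG.boundaryCrossings_le_two hconn.preconnected hp
end

section
/- (Core of Lemma 7: connection cost bound.) Let X be a metric space and let u₀, u₁, …, u_k be requests with positions pos(u_i) ∈ X. Let 𝒮 be a finite family of subsets of the request set, y : 𝒮 → ℝ≥0, and sur : 𝒮 → ℕ. Suppose that: (i) for every i ∈ {1,…,k}, dist(pos(u_{i−1}), pos(u_i)) ≤ Σ_{S ∈ 𝒮 : exactly one of u_{i−1},u_i lies in S} y_S; (ii) for every S ∈ 𝒮 with y_S > 0, sur(S) ≥ 1; and (iii) for every S ∈ 𝒮, the number of indices i such that exactly one of u_{i−1}, u_i lies in S is at most 2. Then dist(pos(u₀), pos(u_k)) ≤ 2 · Σ_{S ∈ 𝒮} sur(S) · y_S. -/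
/-- core of Lemma 7: connection cost bound. If along a path of
requests `u 0, u 1, …, u k` every consecutive distance is paid for by the dual
variables of the sets it crosses, dual variables are positive only on sets of
positive surplus, and each set's boundary is crossed at most twice, then
`dist(pos (u 0), pos (u k)) ≤ 2 · Σ_{S ∈ 𝒮} sur(S) · y_S`. -/
theorem stmt_8 {V : Type*} [DecidableEq V] {X : Type*} [MetricSpace X]
    (pos : V → X) (k : ℕ) (u : ℕ → V)
    (𝒮 : Finset (Finset V)) (y : Finset V → ℝ) (sur : Finset V → ℕ)
    (hynonneg : ∀ S ∈ 𝒮, 0 ≤ y S)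
    (h1 : ∀ i ∈ Finset.Icc 1 k,
      dist (pos (u (i - 1))) (pos (u i)) ≤
        ∑ S ∈ 𝒮.filter (fun S =>
          (u (i - 1) ∈ S ∧ u i ∉ S) ∨ (u (i - 1) ∉ S ∧ u i ∈ S)), y S)
    (h2 : ∀ S ∈ 𝒮, 0 < y S → 1 ≤ sur S)
    (h3 : ∀ S ∈ 𝒮,
      ((Finset.Icc 1 k).filter (fun i =>
        (u (i - 1) ∈ S ∧ u i ∉ S) ∨ (u (i - 1) ∉ S ∧ u i ∈ S))).card ≤ 2) :
    dist (pos (u 0)) (pos (u k)) ≤ 2 * ∑ S ∈ 𝒮, (sur S : ℝ) * y S := by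
  have hpath : dist (pos (u 0)) (pos (u k)) ≤
      ∑ i ∈ Finset.Icc 1 k, dist (pos (u (i - 1))) (pos (u i)) := by
    clear h1 h3
    induction k with
    | zero => simp
    | succ n ih =>
      rw [Finset.sum_Icc_succ_top (by omega), Nat.add_sub_cancel]
      exact (dist_triangle _ (pos (u n)) _).trans (by gcongr)
  refine (hpath.trans (Finset.sum_le_sum h1)).trans ?_
  simp only [Finset.sum_filter]
  rw [Finset.sum_comm, Finset.mul_sum]
  refine Finset.sum_le_sum fun S hS => ?_
  rw [← Finset.sum_filter, Finset.sum_const, nsmul_eq_mul]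
  have hcard := (Nat.cast_le (α := ℝ)).mpr (h3 S hS)
  push_cast at hcard
  refine mul_le_mul hcard ?_ (hynonneg S hS) zero_le_two
  rcases (hynonneg S hS).eq_or_lt with h | h
  · simp [← h]
  · exact le_mul_of_one_le_left h.le (by exact_mod_cast h2 S hS h)
end
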